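/- arXiv:1902.10040 — 2 statements merged into one kernel-verified Lean document; each statement's English description precedes it below -/
import Mathlib

section
/- The formal power series ω₀(z₁,z₂) = Σ_{a,b≥0} A(a+b)·((a+b)!)³/((a!)³(b!)³)·z₁^a z₂^b in ℚ[[z₁,z₂]] is annihilated by the Picard–Fuchs operator P₁ = p₂₀θ₁² + p₁₁θ₁θ₂ + p₀₂θ₂² + p₁₀θ₁ + p₀₁θ₂ + p₀₀, where p₂₀ = z₁²+11z₁z₂+10z₂²+11z₁+11z₂−1, p₁₁ = 5z₁²+10z₁z₂+5z₂²+22z₁+22z₂+1, p₀₂ = 10z₁²+11z₁z₂+z₂²+11z₁+11z₂−1, p₁₀ = (z₁+z₂)(2z₁+5z₂+11), p₀₁ = (z₁+z₂)(5z₁+2z₂+11), p₀₀ = (z₁+z₂)(z₁+z₂+3). That is, P₁ω₀ = 0 in ℚ[[z₁,z₂]]. -/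
/-!
The two-variable period series ω₀(z₁,z₂) = Σ A(a+b)·((a+b)!)³/((a!)³(b!)³)·z₁^a z₂^b
is annihilated by the Picard–Fuchs operator P₁.
-/

noncomputable section

/-- The Apéry-like numbers `A(n) = Σ_{k=0}^n C(n,k)² C(n+k,k)` (as rationals). -/
def apery (n : ℕ) : ℚ :=
  ∑ k ∈ Finset.range (n + 1), ((n.choose k : ℚ)) ^ 2 * ((n + k).choose k : ℚ)

/-- The coefficient `c(a,b) = A(a+b)·((a+b)!)³/((a!)³(b!)³)`. -/
def coefOmega (a b : ℕ) : ℚ :=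
  apery (a + b) * ((a + b).factorial : ℚ) ^ 3 /
    (((a.factorial : ℚ)) ^ 3 * ((b.factorial : ℚ)) ^ 3)

/-- The formal power series `ω₀(z₁,z₂)` in `ℚ[[z₁,z₂]]`. -/
def omega0 : MvPowerSeries (Fin 2) ℚ := fun d => coefOmega (d 0) (d 1)

/-- The logarithmic derivation `θᵢ = zᵢ ∂/∂zᵢ` on `ℚ[[z₁,z₂]]`. -/
def theta (i : Fin 2) (f : MvPowerSeries (Fin 2) ℚ) : MvPowerSeries (Fin 2) ℚ :=
  fun d => (d i : ℚ) * f d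

/-- The variable `z₁`. -/
def z₁ : MvPowerSeries (Fin 2) ℚ := MvPowerSeries.X 0

/-- The variable `z₂`. -/
def z₂ : MvPowerSeries (Fin 2) ℚ := MvPowerSeries.X 1

/-- The summand `C(n,k)² C(n+k,k)` of `apery n`. -/
def aperyTerm (n k : ℕ) : ℚ :=
  (n.choose k : ℚ) ^ 2 * ((n + k).choose k : ℚ)

/-- The antidifference certifying the recurrence of the Apéry-like numbers. -/
def aperyCertificate (n k : ℕ) : ℚ :=
  ((k : ℚ) ^ 2 + 3 * (2 * n + 1) * k - 11 * n ^ 2 - 9 * n - 2) * aperyTerm n k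

lemma apery_eq_sum_range {n N : ℕ} (h : n + 1 ≤ N) :
    apery n = ∑ k ∈ Finset.range N, aperyTerm n k := by
  refine Finset.sum_subset (Finset.range_mono h) fun k _ hk => ?_
  rw [Finset.mem_range, not_lt] at hk
  simp [Nat.choose_eq_zero_of_lt (show n < k by omega)]

lemma cast_succ_choose_succ (n k : ℕ) :
    ((n + 1).choose (k + 1) : ℚ) = n.choose k * (n + 1) / (k + 1) := by
  rw [eq_div_iff (by positivity)]
  have h := Nat.add_one_mul_choose_eq n k
  have h' : ((n : ℚ) + 1) * n.choose k = (n + 1).choose (k + 1) * (k + 1) := by exact_mod_cast h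
  linarith

lemma cast_choose_succ (n k : ℕ) :
    (n.choose (k + 1) : ℚ) = n.choose k * (n - k) / (k + 1) := by
  have h := cast_succ_choose_succ n k
  rw [Nat.choose_succ_succ, Nat.cast_add] at h
  have hk : (k : ℚ) + 1 ≠ 0 := by positivity
  field_simp at h ⊢
  linarith

lemma cast_choose_eq_succ_choose (n k : ℕ) :
    (n.choose k : ℚ) = (n + 1).choose k * (n + 1 - k) / (n + 1) := by
  have h := cast_choose_succ (n + 1) k
  rw [cast_succ_choose_succ] at h
  have hk : (k : ℚ) + 1 ≠ 0 := by positivity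
  have hn : (n : ℚ) + 1 ≠ 0 := by positivity
  push_cast at h
  field_simp at h ⊢
  linarith

lemma aperyCertificate_succ (m k : ℕ) :
    aperyCertificate (m + 1) (k + 1) - aperyCertificate (m + 1) k =
      ((m : ℚ) + 2) ^ 2 * aperyTerm (m + 2) (k + 1)
        - (11 * ((m : ℚ) + 1) ^ 2 + 11 * (m + 1) + 3) * aperyTerm (m + 1) (k + 1)
        - ((m : ℚ) + 1) ^ 2 * aperyTerm m (k + 1) := by
  have hk : (k : ℚ) + 1 ≠ 0 := by positivity
  have hm : (m : ℚ) + 1 ≠ 0 := by positivity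
  have hm' : (m : ℚ) + 2 ≠ 0 := by positivity
  have h₁ := cast_choose_succ (m + 1) k
  have h₂ := cast_choose_succ m k
  rw [cast_choose_eq_succ_choose m k] at h₂
  have h₃ := cast_succ_choose_succ (m + 1) k
  have h₄ := cast_succ_choose_succ (m + 1 + k) k
  have h₅ := cast_choose_succ (m + 1 + k) k
  have h₆ := cast_choose_eq_succ_choose (m + 1 + k + 1) (k + 1)
  rw [h₄] at h₆
  have h₇ : ((m + 1 + k + 1 + 1).choose (k + 1) : ℚ) =
      (m + 1 + k).choose k * ((m + k + 2) * (m + k + 3)) / ((k + 1) * (m + 2)) := by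
    push_cast at h₆
    have : (m : ℚ) + 1 + k + 1 + 1 ≠ 0 := by positivity
    field_simp at h₆ ⊢
    linear_combination -h₆
  rw [aperyCertificate, aperyCertificate, aperyTerm, aperyTerm, aperyTerm, aperyTerm,
    show m + 2 + (k + 1) = m + 1 + k + 1 + 1 by ring, show m + 1 + (k + 1) = m + 1 + k + 1 by ring,
    show m + (k + 1) = m + 1 + k by ring, show m + 2 = m + 1 + 1 from rfl, h₁, h₂, h₃, h₄, h₅, h₇]
  push_cast
  field_simp
  ring

lemma sum_range_aperyTerm (m K : ℕ) :
    ∑ k ∈ Finset.range (K + 1), (((m : ℚ) + 2) ^ 2 * aperyTerm (m + 2) k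
        - (11 * ((m : ℚ) + 1) ^ 2 + 11 * (m + 1) + 3) * aperyTerm (m + 1) k
        - ((m : ℚ) + 1) ^ 2 * aperyTerm m k) = aperyCertificate (m + 1) K := by
  induction K with
  | zero => simp [aperyTerm, aperyCertificate]; ring
  | succ K ih => rw [Finset.sum_range_succ, ih, ← aperyCertificate_succ]; ring

/-- The three-term recurrence of the Apéry-like numbers. -/
lemma apery_recurrence (m : ℕ) :
    ((m : ℚ) + 2) ^ 2 * apery (m + 2) =
      (11 * ((m : ℚ) + 1) ^ 2 + 11 * (m + 1) + 3) * apery (m + 1)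
        + ((m : ℚ) + 1) ^ 2 * apery m := by
  have h := sum_range_aperyTerm m (m + 2)
  rw [Finset.sum_sub_distrib, Finset.sum_sub_distrib, ← Finset.mul_sum, ← Finset.mul_sum,
    ← Finset.mul_sum, ← apery_eq_sum_range (by omega), ← apery_eq_sum_range (by omega),
    ← apery_eq_sum_range (by omega)] at h
  have h₀ : aperyCertificate (m + 1) (m + 2) = 0 := by simp [aperyCertificate, aperyTerm]
  linarith

/-- The numerators `A(n) (n!)³` of the coefficients of `ω₀`. -/
def aperyFactorial (n : ℕ) : ℚ := apery n * (n.factorial : ℚ) ^ 3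

lemma aperyFactorial_recurrence {n : ℕ} (hn : n ≠ 0) :
    aperyFactorial n =
      n * (11 * ((n : ℚ) - 1) ^ 2 + 11 * (n - 1) + 3) * aperyFactorial (n - 1)
        + n * ((n : ℚ) - 1) ^ 5 * aperyFactorial (n - 1 - 1) := by
  match n, hn with
  | 1, _ => norm_num [aperyFactorial, apery, Finset.sum_range_succ]
  | m + 2, _ =>
    have h := apery_recurrence m
    simp only [aperyFactorial, Nat.add_sub_cancel, show m + 2 - 1 = m + 1 from rfl,
      Nat.factorial_succ]
    push_cast
    linear_combination ((m : ℚ) + 2) * ((m + 1) * m.factorial) ^ 3 * h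

/-- The power series with coefficients `p(a,b) s(a+b) / ((a!)³ (b!)³)`. -/
def cubicSeries (p : ℚ → ℚ → ℚ) (s : ℕ → ℚ) : MvPowerSeries (Fin 2) ℚ :=
  fun d => p (d 0) (d 1) * s (d 0 + d 1) /
    (((d 0).factorial : ℚ) ^ 3 * ((d 1).factorial : ℚ) ^ 3)

lemma omega0_eq_cubicSeries : omega0 = cubicSeries (fun _ _ => 1) aperyFactorial := by
  funext d
  simp [omega0, cubicSeries, coefOmega, aperyFactorial]

lemma theta_zero_cubicSeries (p : ℚ → ℚ → ℚ) (s : ℕ → ℚ) :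
    theta 0 (cubicSeries p s) = cubicSeries (fun a b => a * p a b) s := by
  funext d
  simp only [theta, cubicSeries]
  ring

lemma theta_one_cubicSeries (p : ℚ → ℚ → ℚ) (s : ℕ → ℚ) :
    theta 1 (cubicSeries p s) = cubicSeries (fun a b => b * p a b) s := by
  funext d
  simp only [theta, cubicSeries]
  ring

lemma coeff_cubicSeries (p : ℚ → ℚ → ℚ) (s : ℕ → ℚ) (d : Fin 2 →₀ ℕ) :
    MvPowerSeries.coeff d (cubicSeries p s) = p (d 0) (d 1) * s (d 0 + d 1) /
      (((d 0).factorial : ℚ) ^ 3 * ((d 1).factorial : ℚ) ^ 3) :=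
  rfl

lemma coeff_X_mul_eq_ite (i : Fin 2) (f : MvPowerSeries (Fin 2) ℚ) (d : Fin 2 →₀ ℕ) :
    MvPowerSeries.coeff d (MvPowerSeries.X i * f) =
      if d i = 0 then 0 else MvPowerSeries.coeff (d - Finsupp.single i 1) f := by
  classical
  rw [MvPowerSeries.X, MvPowerSeries.coeff_monomial_mul]
  simp only [Finsupp.single_le_iff, Nat.one_le_iff_ne_zero, one_mul, ite_not]

lemma z₁_mul_cubicSeries (p : ℚ → ℚ → ℚ) (s : ℕ → ℚ) :
    z₁ * cubicSeries p s =
      cubicSeries (fun a b => a ^ 3 * p (a - 1) b) (fun n => s (n - 1)) := by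
  ext d
  rw [z₁, coeff_X_mul_eq_ite]
  split_ifs with h
  · simp [coeff_cubicSeries, h]
  · obtain ⟨a, ha⟩ := Nat.exists_eq_succ_of_ne_zero h
    simp only [coeff_cubicSeries, Finsupp.tsub_apply, ha, Finsupp.single_eq_same, Nat.succ_eq_add_one,
      Finsupp.single_eq_of_ne (show (1 : Fin 2) ≠ 0 by decide), Nat.add_sub_cancel, Nat.sub_zero,
      Nat.factorial_succ, show a + 1 + d 1 - 1 = a + d 1 by omega]
    push_cast
    rw [add_sub_cancel_right]
    have : (a : ℚ) + 1 ≠ 0 := by positivity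
    field_simp

lemma z₂_mul_cubicSeries (p : ℚ → ℚ → ℚ) (s : ℕ → ℚ) :
    z₂ * cubicSeries p s =
      cubicSeries (fun a b => b ^ 3 * p a (b - 1)) (fun n => s (n - 1)) := by
  ext d
  rw [z₂, coeff_X_mul_eq_ite]
  split_ifs with h
  · simp [coeff_cubicSeries, h]
  · obtain ⟨b, hb⟩ := Nat.exists_eq_succ_of_ne_zero h
    simp only [coeff_cubicSeries, Finsupp.tsub_apply, hb, Finsupp.single_eq_same, Nat.succ_eq_add_one,
      Finsupp.single_eq_of_ne (show (0 : Fin 2) ≠ 1 by decide), Nat.add_sub_cancel, Nat.sub_zero,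
      Nat.factorial_succ, show d 0 + (b + 1) - 1 = d 0 + b by omega]
    push_cast
    rw [add_sub_cancel_right]
    have : (b : ℚ) + 1 ≠ 0 := by positivity
    field_simp

lemma ofNat_mul_cubicSeries (c : ℕ) [c.AtLeastTwo] (p : ℚ → ℚ → ℚ) (s : ℕ → ℚ) :
    (ofNat(c) : MvPowerSeries (Fin 2) ℚ) * cubicSeries p s =
      cubicSeries (fun a b => ofNat(c) * p a b) s := by
  ext d
  rw [← map_ofNat MvPowerSeries.C c, MvPowerSeries.coeff_C_mul, coeff_cubicSeries,
    coeff_cubicSeries]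
  ring

/-- `P₁ ω₀ = 0` in `ℚ[[z₁,z₂]]`. -/
theorem P1_annihilates_omega0 :
    (z₁ ^ 2 + 11 * z₁ * z₂ + 10 * z₂ ^ 2 + 11 * z₁ + 11 * z₂ - 1) * theta 0 (theta 0 omega0)
    + (5 * z₁ ^ 2 + 10 * z₁ * z₂ + 5 * z₂ ^ 2 + 22 * z₁ + 22 * z₂ + 1) * theta 0 (theta 1 omega0)
    + (10 * z₁ ^ 2 + 11 * z₁ * z₂ + z₂ ^ 2 + 11 * z₁ + 11 * z₂ - 1) * theta 1 (theta 1 omega0)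
    + (z₁ + z₂) * (2 * z₁ + 5 * z₂ + 11) * theta 0 omega0
    + (z₁ + z₂) * (5 * z₁ + 2 * z₂ + 11) * theta 1 omega0
    + (z₁ + z₂) * (z₁ + z₂ + 3) * omega0 = 0 := by
  rw [omega0_eq_cubicSeries]
  simp only [theta_zero_cubicSeries, theta_one_cubicSeries, pow_two, add_mul, sub_mul, mul_add,
    mul_assoc, one_mul, z₁_mul_cubicSeries, z₂_mul_cubicSeries, ofNat_mul_cubicSeries]
  ext d
  simp only [map_add, map_sub, map_zero, coeff_cubicSeries]
  rcases eq_or_ne (d 0 + d 1) 0 with h | h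
  · obtain ⟨h₀, h₁⟩ := Nat.add_eq_zero_iff.mp h
    simp [h₀, h₁]
  · have hrec := aperyFactorial_recurrence h
    push_cast at hrec
    linear_combination (-((d 0 : ℚ) ^ 2 - d 0 * d 1 + (d 1 : ℚ) ^ 2) /
      (((d 0).factorial : ℚ) ^ 3 * ((d 1).factorial : ℚ) ^ 3)) * hrec

end
end

section
/- Let ζ = e^{2πi/3} ∈ ℂ be a primitive cube root of unity, and for x, y, c : Fin 3 → ℂ consider the three bilinear forms e₁ = c₀x₀y₀ + c₁x₁y₂ + c₂x₂y₁, e₂ = c₀x₁y₁ + c₁x₂y₀ + c₂x₀y₂, e₃ = c₀x₂y₂ + c₁x₀y₁ + c₂x₁y₀. Then each of the three transformations g₁ : (x,y,c) ↦ ((x₀,ζx₁,x₂),(y₀,y₁,ζy₂),(c₀,ζc₁,c₂)), g₂ : (x,y,c) ↦ ((x₀,x₁,ζx₂),(y₀,ζy₁,y₂),(c₀,c₁,ζc₂)), g₃ : (x,y,c) ↦ ((x₀,ζx₁,ζ²x₂),(y₀,ζy₁,ζ²y₂),(c₀,c₁,c₂)) maps the common zero locus {e₁ = e₂ = e₃ =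 0} into itself: each eᵢ is multiplied by a cube root of unity under each transformation. -/
/-!
The three generators of `G ≅ (ℤ/3)³` preserve the common zero locus of the three
bilinear forms `e₁, e₂, e₃` cutting out `T₀ ⊂ ℙ²_x × ℙ²_y × ℙ²_c`: each `eᵢ` is
multiplied by a cube root of unity under each transformation.
-/

noncomputable section

/-- `ζ = e^{2πi/3}`, a primitive cube root of unity. -/
def zeta : ℂ := Complex.exp (2 * Real.pi * Complex.I / 3)

/-- `e₁ = c₀x₀y₀ + c₁x₁y₂ + c₂x₂y₁`. -/
def e1 (x y c : Fin 3 → ℂ) : ℂ := c 0 * x 0 * y 0 + c 1 * x 1 * y 2 + c 2 * x 2 * y 1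

/-- `e₂ = c₀x₁y₁ + c₁x₂y₀ + c₂x₀y₂`. -/
def e2 (x y c : Fin 3 → ℂ) : ℂ := c 0 * x 1 * y 1 + c 1 * x 2 * y 0 + c 2 * x 0 * y 2

/-- `e₃ = c₀x₂y₂ + c₁x₀y₁ + c₂x₁y₀`. -/
def e3 (x y c : Fin 3 → ℂ) : ℂ := c 0 * x 2 * y 2 + c 1 * x 0 * y 1 + c 2 * x 1 * y 0

/-- `g₁ : (x,y,c) ↦ ((x₀,ζx₁,x₂),(y₀,y₁,ζy₂),(c₀,ζc₁,c₂))`. -/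
def g1 (x y c : Fin 3 → ℂ) : (Fin 3 → ℂ) × (Fin 3 → ℂ) × (Fin 3 → ℂ) :=
  (![x 0, zeta * x 1, x 2], ![y 0, y 1, zeta * y 2], ![c 0, zeta * c 1, c 2])

/-- `g₂ : (x,y,c) ↦ ((x₀,x₁,ζx₂),(y₀,ζy₁,y₂),(c₀,c₁,ζc₂))`. -/
def g2 (x y c : Fin 3 → ℂ) : (Fin 3 → ℂ) × (Fin 3 → ℂ) × (Fin 3 → ℂ) :=
  (![x 0, x 1, zeta * x 2], ![y 0, zeta * y 1, y 2], ![c 0, c 1, zeta * c 2])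

/-- `g₃ : (x,y,c) ↦ ((x₀,ζx₁,ζ²x₂),(y₀,ζy₁,ζ²y₂),(c₀,c₁,c₂))`. -/
def g3 (x y c : Fin 3 → ℂ) : (Fin 3 → ℂ) × (Fin 3 → ℂ) × (Fin 3 → ℂ) :=
  (![x 0, zeta * x 1, zeta ^ 2 * x 2], ![y 0, zeta * y 1, zeta ^ 2 * y 2], ![c 0, c 1, c 2])

theorem zeta_pow_three : zeta ^ 3 = 1 := by
  rw [zeta, ← Complex.exp_nat_mul, ← Complex.exp_two_pi_mul_I]
  congr 1
  push_cast
  ring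

/-- Each of `e₁, e₂, e₃` is multiplied by a cube root of unity under each of
`g₁, g₂, g₃`; in particular each `gᵢ` maps the common zero locus
`{e₁ = e₂ = e₃ = 0}` into itself. -/
theorem G_preserves_T0 (x y c : Fin 3 → ℂ) :
    (∀ e ∈ ({e1, e2, e3} : Set ((Fin 3 → ℂ) → (Fin 3 → ℂ) → (Fin 3 → ℂ) → ℂ)),
      ∀ g ∈ ({g1, g2, g3} :
          Set ((Fin 3 → ℂ) → (Fin 3 → ℂ) → (Fin 3 → ℂ) →
            (Fin 3 → ℂ) × (Fin 3 → ℂ) × (Fin 3 → ℂ))),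
        ∃ μ : ℂ, μ ^ 3 = 1 ∧
          e (g x y c).1 (g x y c).2.1 (g x y c).2.2 = μ * e x y c)
    ∧ (∀ g ∈ ({g1, g2, g3} :
          Set ((Fin 3 → ℂ) → (Fin 3 → ℂ) → (Fin 3 → ℂ) →
            (Fin 3 → ℂ) × (Fin 3 → ℂ) × (Fin 3 → ℂ))),
        (e1 x y c = 0 ∧ e2 x y c = 0 ∧ e3 x y c = 0) →
          (e1 (g x y c).1 (g x y c).2.1 (g x y c).2.2 = 0
            ∧ e2 (g x y c).1 (g x y c).2.1 (g x y c).2.2 = 0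
            ∧ e3 (g x y c).1 (g x y c).2.1 (g x y c).2.2 = 0)) := by
  have h3 := zeta_pow_three
  have scaling : ∀ e ∈ ({e1, e2, e3} : Set ((Fin 3 → ℂ) → (Fin 3 → ℂ) → (Fin 3 → ℂ) → ℂ)),
      ∀ g ∈ ({g1, g2, g3} :
          Set ((Fin 3 → ℂ) → (Fin 3 → ℂ) → (Fin 3 → ℂ) →
            (Fin 3 → ℂ) × (Fin 3 → ℂ) × (Fin 3 → ℂ))),
        ∃ μ : ℂ, μ ^ 3 = 1 ∧
          e (g x y c).1 (g x y c).2.1 (g x y c).2.2 = μ * e x y c := by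
    have h6 : (zeta ^ 2) ^ 3 = 1 := by rw [← pow_mul, mul_comm, pow_mul, h3, one_pow]
    rintro e (rfl | rfl | rfl) g (rfl | rfl | rfl)
    · refine ⟨1, one_pow 3, ?_⟩
      simp [e1, g1]
      linear_combination (c 1 * x 1 * y 2) * h3
    · refine ⟨1, one_pow 3, ?_⟩
      simp [e1, g2]
      linear_combination (c 2 * x 2 * y 1) * h3
    · refine ⟨1, one_pow 3, ?_⟩
      simp [e1, g3]
      linear_combination (c 1 * x 1 * y 2 + c 2 * x 2 * y 1) * h3
    · refine ⟨zeta, h3, ?_⟩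
      simp [e2, g1]
      ring
    · refine ⟨zeta, h3, ?_⟩
      simp [e2, g2]
      ring
    · refine ⟨zeta ^ 2, h6, ?_⟩
      simp [e2, g3]
      ring
    · refine ⟨zeta, h3, ?_⟩
      simp [e3, g1]
      ring
    · refine ⟨zeta, h3, ?_⟩
      simp [e3, g2]
      ring
    · refine ⟨zeta, h3, ?_⟩
      simp [e3, g3]
      linear_combination (zeta * c 0 * x 2 * y 2) * h3
  refine ⟨scaling, ?_⟩
  rintro g hg ⟨h₁, h₂, h₃⟩
  obtain ⟨μ₁, -, hμ₁⟩ := scaling e1 (by simp) g hg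
  obtain ⟨μ₂, -, hμ₂⟩ := scaling e2 (by simp) g hg
  obtain ⟨μ₃, -, hμ₃⟩ := scaling e3 (by simp) g hg
  exact ⟨by rw [hμ₁, h₁, mul_zero], by rw [hμ₂, h₂, mul_zero], by rw [hμ₃, h₃, mul_zero]⟩

end
end
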